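/- arXiv:1603.07460 — 3 statements merged into one kernel-verified Lean document; each statement's English description precedes it below -/
import Mathlib

section
/- Let λ > 0, let (c_n) be a sequence of positive reals with c_n → ∞, and let (t_n) be a sequence of nonnegative reals with (t_n − λ c_n)/√(c_n) → 0. Then the ratio [e^{−λ c_n} (λ c_n)^{⌊t_n⌋}/⌊t_n⌋!] / [e^{−λ c_n} (λ c_n)^{⌊λ c_n⌋}/⌊λ c_n⌋!] → 1 as n → ∞; i.e. P(Π(λ c_n) = ⌊t_n⌋)/P(Π(λ c_n) = ⌊λ c_n⌋) → 1. -/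
open Filter Real

/-- Two Poisson weights of intensity `x` at integers within `δ ≤ x / 2` of `x` have logarithms
that differ by at most `4 δ² / x`. -/
lemma abs_log_poisson_sub_le {x δ : ℝ} (hx : 0 < x) (hδ : 0 ≤ δ) (hδx : δ ≤ x / 2) {k m : ℕ}
    (hk : |(k : ℝ) - x| ≤ δ) (hm : |(m : ℝ) - x| ≤ δ) :
    |Real.log (Real.exp (-x) * x ^ m / (Nat.factorial m : ℝ)) -
      Real.log (Real.exp (-x) * x ^ k / (Nat.factorial k : ℝ))| ≤ 4 * (δ ^ 2 / x) := by
  wlog hkm : k ≤ m generalizing k m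
  · rw [abs_sub_comm]
    exact this hm hk (by omega)
  rw [abs_le] at hk hm
  have hstep : ∀ {j : ℕ}, k ≤ j → j < m →
      dist (Real.log (Real.exp (-x) * x ^ j / (Nat.factorial j : ℝ)))
        (Real.log (Real.exp (-x) * x ^ (j + 1) / (Nat.factorial (j + 1) : ℝ))) ≤ 2 * (δ / x) := by
    intro j hkj hjm
    have h1 : (k : ℝ) ≤ j := by exact_mod_cast hkj
    have h2 : (j : ℝ) + 1 ≤ m := by exact_mod_cast hjm
    have hy : (0 : ℝ) < j + 1 := by positivity
    have hsplit : Real.exp (-x) * x ^ (j + 1) / (Nat.factorial (j + 1) : ℝ) =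
        Real.exp (-x) * x ^ j / (Nat.factorial j : ℝ) * (x / (j + 1)) := by
      rw [Nat.factorial_succ]
      push_cast
      field_simp
      ring
    rw [hsplit, Real.log_mul (by positivity) (by positivity), dist_self_add_right,
      Real.norm_eq_abs, abs_le]
    constructor
    · have h3 := Real.log_le_sub_one_of_pos (div_pos hy hx)
      have h4 : Real.log ((j + 1) / x) = -Real.log (x / (j + 1)) := by
        rw [← Real.log_inv, inv_div]
      have h5 : ((j : ℝ) + 1) / x - 1 ≤ 2 * (δ / x) := by
        rw [div_sub_one hx.ne', ← mul_div_assoc]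
        gcongr
        linarith
      linarith
    · refine (Real.log_le_sub_one_of_pos (div_pos hx hy)).trans ?_
      rw [div_sub_one hy.ne', ← mul_div_assoc, div_le_div_iff₀ hy hx]
      nlinarith
  have hsum := dist_le_Ico_sum_of_dist_le hkm hstep
  rw [dist_comm, Real.dist_eq, Finset.sum_const, Nat.card_Ico, nsmul_eq_mul, Nat.cast_sub hkm]
    at hsum
  calc _ ≤ _ := hsum
    _ ≤ (2 * δ) * (2 * (δ / x)) := by gcongr; linarith
    _ = 4 * (δ ^ 2 / x) := by ring

/-- If `c n → ∞` and `(t n − λ c n)/√(c n) → 0`, then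
`P(Π(λ c n) = ⌊t n⌋) / P(Π(λ c n) = ⌊λ c n⌋) → 1`. -/
theorem stmt4 (lam : ℝ) (hlam : 0 < lam) (c t : ℕ → ℝ)
    (hc_pos : ∀ n, 0 < c n) (hc : Tendsto c atTop atTop)
    (ht : ∀ n, 0 ≤ t n)
    (htc : Tendsto (fun n => (t n - lam * c n) / Real.sqrt (c n)) atTop (nhds 0)) :
    Tendsto (fun n =>
      (Real.exp (-(lam * c n)) * (lam * c n) ^ ⌊t n⌋₊ / (Nat.factorial ⌊t n⌋₊ : ℝ)) /
      (Real.exp (-(lam * c n)) * (lam * c n) ^ ⌊lam * c n⌋₊ / (Nat.factorial ⌊lam * c n⌋₊ : ℝ)))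
      atTop (nhds 1) := by
  have hx : ∀ n, 0 < lam * c n := fun n => mul_pos hlam (hc_pos n)
  have hδ : Tendsto (fun n => (|t n - lam * c n| + 1) ^ 2 / (lam * c n)) atTop (nhds 0) := by
    have h1 : Tendsto (fun n => (Real.sqrt (c n))⁻¹) atTop (nhds 0) :=
      (Real.tendsto_sqrt_atTop.comp hc).inv_tendsto_atTop
    have h2 := ((htc.abs.add h1).pow 2).div_const lam
    simp only [abs_zero, add_zero, ne_eq, OfNat.ofNat_ne_zero, not_false_eq_true, zero_pow,
      zero_div] at h2
    refine h2.congr fun n => ?_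
    rw [abs_div, abs_of_nonneg (Real.sqrt_nonneg _), inv_eq_one_div, ← add_div, div_pow,
      Real.sq_sqrt (hc_pos n).le, div_div, mul_comm lam]
  have hlog : Tendsto (fun n =>
      Real.log (Real.exp (-(lam * c n)) * (lam * c n) ^ ⌊t n⌋₊ / (Nat.factorial ⌊t n⌋₊ : ℝ)) -
      Real.log (Real.exp (-(lam * c n)) * (lam * c n) ^ ⌊lam * c n⌋₊ /
        (Nat.factorial ⌊lam * c n⌋₊ : ℝ))) atTop (nhds 0) := by
    refine squeeze_zero_norm' ?_ (by simpa using hδ.const_mul 4)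
    filter_upwards [hδ.eventually_le_const one_pos,
      (hc.const_mul_atTop hlam).eventually_ge_atTop 4] with n hn1 hn2
    rw [div_le_one (hx n)] at hn1
    have ht1 := Nat.floor_le (ht n)
    have ht2 := Nat.lt_floor_add_one (t n)
    have hx1 := Nat.floor_le (hx n).le
    have hx2 := Nat.lt_floor_add_one (lam * c n)
    have hle := le_abs_self (t n - lam * c n)
    have hge := neg_abs_le (t n - lam * c n)
    have hnonneg := abs_nonneg (t n - lam * c n)
    refine abs_log_poisson_sub_le (hx n) (by positivity) ?_ ?_ ?_
    · nlinarith
    · rw [abs_le]; constructor <;> linarith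
    · rw [abs_le]; constructor <;> linarith
  have hexp := (Real.continuous_exp.tendsto 0).comp hlog
  rw [Real.exp_zero] at hexp
  refine hexp.congr fun n => ?_
  have := hx n
  rw [Function.comp_apply, Real.exp_sub, Real.exp_log (by positivity), Real.exp_log (by positivity)]
end

section
/- Let λ > 0 and ω > 0. There exists c₀ > 0 such that for every real c ≥ c₀ and every m ∈ ℕ with |m − λ c| ≤ ω √(λ c), one has e^{−λ c} (λ c)^m / m! ≥ (1/2) (2π λ c)^{−1/2} e^{−ω²/2}. -/
open Real

lemma one_add_mul_log_one_add_le {u : ℝ} (hu : |u| ≤ 1 / 2) :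
    (1 + u) * log (1 + u) ≤ u + u ^ 2 / 2 + 4 * |u| ^ 3 := by
  have h := Real.abs_log_sub_add_sum_range_le (x := -u) (by rw [abs_neg]; linarith) 2
  have hdiv : |u| ^ 3 / (1 - |u|) ≤ 2 * |u| ^ 3 := by
    rw [div_le_iff₀ (by linarith)]
    nlinarith [pow_nonneg (abs_nonneg u) 3]
  simp only [Finset.sum_range_succ, Finset.sum_range_zero, abs_neg, sub_neg_eq_add] at h
  norm_num at h
  have hlog : log (1 + u) ≤ u - u ^ 2 / 2 + 2 * |u| ^ 3 := by
    linarith [(abs_le.mp h).2]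
  obtain ⟨hl, hr⟩ := abs_le.mp hu
  have hmul := mul_le_mul_of_nonneg_left hlog (by linarith : (0 : ℝ) ≤ 1 + u)
  have hcube : -u ^ 3 ≤ |u| ^ 3 := by
    rw [← abs_pow]
    exact neg_le_abs _
  nlinarith [mul_nonneg (pow_nonneg (abs_nonneg u) 3) (by linarith : (0 : ℝ) ≤ 1 / 2 - u),
    pow_nonneg (abs_nonneg u) 3]

lemma eventually_factorial_le_mul_stirling {K : ℝ} (hK : 1 < K) :
    ∀ᶠ n : ℕ in Filter.atTop,
      (n.factorial : ℝ) ≤ K * (√(2 * π * n) * (n / exp 1) ^ n) := by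
  have hlt : √π < K * √π := lt_mul_of_one_lt_left (by positivity) hK
  filter_upwards [Stirling.tendsto_stirlingSeq_sqrt_pi.eventually (gt_mem_nhds hlt),
    Filter.eventually_gt_atTop 0] with n hn hn0
  have hpos : (0 : ℝ) < n := by exact_mod_cast hn0
  rw [Stirling.stirlingSeq, div_lt_iff₀ (by positivity)] at hn
  have hsqrt : √(2 * π * n) = √π * √(2 * n) := by
    rw [← sqrt_mul pi_pos.le]
    congr 1
    ring
  rw [hsqrt]
  calc (n.factorial : ℝ) ≤ _ := hn.le
    _ = _ := by ring

/-- If `|m - s²| ≤ ω s` with `s` large, then `(m / e) ^ m` exceeds `(s²) ^ m * exp (-s²)` by a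
factor of at most `exp (ω² / 2 + 4 ω³ / s)`. -/
lemma div_exp_one_pow_le {ω s : ℝ} (hs : 0 < s) (hωs : 2 * ω ≤ s) {m : ℕ}
    (hm : |(m : ℝ) - s ^ 2| ≤ ω * s) :
    ((m : ℝ) / exp 1) ^ m ≤ (s ^ 2) ^ m * exp (-s ^ 2 + ω ^ 2 / 2 + 4 * ω ^ 3 / s) := by
  obtain ⟨u, hu⟩ : ∃ u : ℝ, (m : ℝ) = s ^ 2 * (1 + u) :=
    ⟨m / s ^ 2 - 1, by field_simp; ring⟩
  have hsu : s * |u| ≤ ω := by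
    have : (m : ℝ) - s ^ 2 = s ^ 2 * u := by rw [hu]; ring
    rw [this, abs_mul, abs_of_pos (by positivity)] at hm
    nlinarith
  have hu2 : |u| ≤ 1 / 2 := by nlinarith
  have h1u : 0 < 1 + u := by linarith [(abs_le.mp hu2).1]
  have hsq : s ^ 2 * u ^ 2 ≤ ω ^ 2 := by
    have := pow_le_pow_left₀ (by positivity) hsu 2
    rwa [mul_pow, sq_abs] at this
  have hcube : s ^ 2 * |u| ^ 3 ≤ ω ^ 3 / s := by
    rw [le_div_iff₀ hs]
    calc _ = (s * |u|) ^ 3 := by ring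
      _ ≤ _ := pow_le_pow_left₀ (by positivity) hsu 3
  have hlog := mul_le_mul_of_nonneg_left (one_add_mul_log_one_add_le hu2) (sq_nonneg s)
  have hexp : (m : ℝ) * (log (1 + u) - 1) ≤ -s ^ 2 + ω ^ 2 / 2 + 4 * ω ^ 3 / s := by
    rw [hu]
    have : 4 * ω ^ 3 / s = 4 * (ω ^ 3 / s) := by ring
    rw [this]
    nlinarith
  have hbase : (m : ℝ) / exp 1 = s ^ 2 * exp (log (1 + u) - 1) := by
    rw [exp_sub, exp_log h1u, hu]
    ring
  rw [hbase, mul_pow, ← exp_nat_mul]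
  gcongr

/-- Uniform lower bound for the Poisson pmf in a `√θ`-neighbourhood of the mean:
for `c` large enough, `|m − λc| ≤ ω √(λc)` implies
`P(Π(λc) = m) ≥ (1/2) (2π λ c)^{−1/2} e^{−ω²/2}`. -/
theorem stmt5 (lam ω : ℝ) (hlam : 0 < lam) (hω : 0 < ω) :
    ∃ c₀ > (0 : ℝ), ∀ c : ℝ, c₀ ≤ c → ∀ m : ℕ,
      |(m : ℝ) - lam * c| ≤ ω * Real.sqrt (lam * c) →
      (1 / 2) * (Real.sqrt (2 * π * lam * c))⁻¹ * Real.exp (-ω ^ 2 / 2) ≤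
        Real.exp (-(lam * c)) * (lam * c) ^ m / (Nat.factorial m : ℝ) := by
  obtain ⟨N, hN⟩ := Filter.eventually_atTop.mp
    (eventually_factorial_le_mul_stirling (by norm_num : (1 : ℝ) < 5 / 4))
  set R : ℝ := 2 * ω + 20 * ω ^ 3 + 2 * N + 1 with hR
  have hR0 : 0 < R := by positivity
  refine ⟨R ^ 2 / lam, by positivity, fun c hc m hm => ?_⟩
  rw [div_le_iff₀' hlam] at hc
  have hRs : R ≤ √(lam * c) := le_sqrt_of_sq_le hc
  have hsq : √(lam * c) ^ 2 = lam * c := sq_sqrt ((sq_nonneg R).trans hc)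
  rw [mul_assoc (2 * π) lam c]
  generalize √(lam * c) = s at hm hRs hsq
  rw [← hsq] at hm ⊢
  have hs : 0 < s := hR0.trans_le hRs
  have hω3 : 0 < ω ^ 3 := by positivity
  have hN0 : (0 : ℝ) ≤ N := N.cast_nonneg
  have hωs : 2 * ω ≤ s := by linarith
  obtain ⟨hml, hmr⟩ := abs_le.mp hm
  have hNm : N ≤ m := by
    have : (N : ℝ) ≤ m := by nlinarith
    exact_mod_cast this
  have hsqrt : √(2 * π * m) ≤ 5 / 4 * √(2 * π * s ^ 2) := by
    rw [sqrt_le_left (by positivity), mul_pow, sq_sqrt (by positivity)]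
    have : (m : ℝ) ≤ 25 / 16 * s ^ 2 := by nlinarith
    nlinarith [mul_le_mul_of_nonneg_left this pi_pos.le]
  have herr : exp (4 * ω ^ 3 / s) ≤ 5 / 4 := by
    have h5 : 4 * ω ^ 3 / s ≤ 1 / 5 := by
      rw [div_le_iff₀ hs]
      linarith
    refine (exp_le_exp.mpr h5).trans ?_
    have := exp_bound_div_one_sub_of_interval (x := 1 / 5) (by norm_num) (by norm_num)
    norm_num at this ⊢
    exact this
  have hpow : ((m : ℝ) / exp 1) ^ m ≤
      (s ^ 2) ^ m * (exp (-s ^ 2) * exp (ω ^ 2 / 2) * (5 / 4)) := by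
    refine (div_exp_one_pow_le hs hωs hm).trans ?_
    rw [exp_add, exp_add]
    gcongr
  have hfact : (m.factorial : ℝ) ≤ 5 / 4 * (5 / 4 * √(2 * π * s ^ 2) *
      ((s ^ 2) ^ m * (exp (-s ^ 2) * exp (ω ^ 2 / 2) * (5 / 4)))) := by
    refine (hN m hNm).trans ?_
    gcongr
  have hS : 0 < √(2 * π * s ^ 2) := by positivity
  rw [le_div_iff₀ (by positivity), neg_div, exp_neg (ω ^ 2 / 2)]
  calc _ ≤ 1 / 2 * (√(2 * π * s ^ 2))⁻¹ * (exp (ω ^ 2 / 2))⁻¹ * (5 / 4 * (5 / 4 *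
        √(2 * π * s ^ 2) * ((s ^ 2) ^ m * (exp (-s ^ 2) * exp (ω ^ 2 / 2) * (5 / 4))))) := by
        gcongr
    _ = 125 / 128 * (exp (-s ^ 2) * (s ^ 2) ^ m) := by
        field_simp
        norm_num
    _ ≤ _ := mul_le_of_le_one_left (by positivity) (by norm_num)
end

section
/- Let d ≥ 1, R > 0, and let C : ℝ^d → ℝ be a bounded measurable function with C(x) = 0 whenever ‖x‖_∞ > R. Let A and B be bounded measurable subsets of ℝ^d such that ‖a − b‖_∞ > R for all a ∈ A, b ∈ B, and set S = A ∪ B. Define kernels f_k : ℝ^d × ℝ^d → ℝ recursively by f_1(x,y) = C(x−y) and f_{k+1}(x,y) = ∫_S f_k(x,z) C(z−y) dz for k ≥ 1. Then for every k ≥ 1 and every x ∈ A, y ∈ B, one has f_k(x,y) = 0. -/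
open MeasureTheory

/-- Vanishing of the iterated kernels across two sets at sup-norm distance greater than `R`,
for a bounded measurable kernel `C` supported in the sup-norm ball of radius `R`.
Here `ℝ^d` is modelled as `Fin d → ℝ`, whose norm is the supremum norm. -/
theorem stmt9 (d : ℕ) (hd : 1 ≤ d) (R : ℝ) (hR : 0 < R)
    (C : (Fin d → ℝ) → ℝ) (hCmeas : Measurable C)
    (hCbd : ∃ M : ℝ, ∀ x, |C x| ≤ M)
    (hCsupp : ∀ x, R < ‖x‖ → C x = 0)
    (A B : Set (Fin d → ℝ)) (hA : MeasurableSet A) (hB : MeasurableSet B)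
    (hAbd : Bornology.IsBounded A) (hBbd : Bornology.IsBounded B)
    (hAB : ∀ a ∈ A, ∀ b ∈ B, R < ‖a - b‖)
    (f : ℕ → (Fin d → ℝ) → (Fin d → ℝ) → ℝ)
    (hf1 : ∀ x y, f 1 x y = C (x - y))
    (hfk : ∀ k, 1 ≤ k → ∀ x y, f (k + 1) x y = ∫ z in A ∪ B, f k x z * C (z - y)) :
    ∀ k, 1 ≤ k → ∀ x ∈ A, ∀ y ∈ B, f k x y = 0 := by
  intro k hk x hx
  induction k, hk using Nat.le_induction with
  | base =>
    intro y hy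
    rw [hf1, hCsupp _ (hAB x hx y hy)]
  | succ k hk ih =>
    intro y hy
    rw [hfk k hk]
    refine setIntegral_eq_zero_of_forall_eq_zero ?_
    rintro z (hz | hz)
    · rw [hCsupp _ (hAB z hz y hy), mul_zero]
    · rw [ih z hz, zero_mul]
end
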